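/- There are exactly 48 binary words of length 28 over the alphabet {0,1} that avoid Z₃ = abacaba. -/

import Mathlib

/-- `W` is an instance of the pattern `V`: the image of `V` under a semigroup
homomorphism sending each letter to a nonempty word. -/
def IsInst {α β : Type} (V : List α) (W : List β) : Prop :=
  ∃ φ : α → List β, (∀ a ∈ V, φ a ≠ []) ∧ W = (V.map φ).flatten

/-- `U` encounters `V`: some contiguous subword (infix) of `U` is an instance of `V`. -/
def Encounters {α β : Type} (U : List β) (V : List α) : Prop :=
  ∃ W : List β, W <:+: U ∧ IsInst V W

/-- `U` avoids `V`: `U` does not encounter `V`. -/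
def Avoids {α β : Type} (U : List β) (V : List α) : Prop :=
  ¬ Encounters U V

/-- The Zimin words over the alphabet ℕ: `Z₀ = ε`, `Z_{n+1} = Zₙ · n · Zₙ`. -/
def Zimin : ℕ → List ℕ
  | 0 => []
  | n + 1 => Zimin n ++ n :: Zimin n

/-- `zimf n q` is the smallest `M` such that every `q`-ary word of length `M`
encounters the Zimin word `Zₙ`. -/
noncomputable def zimf (n q : ℕ) : ℕ :=
  sInf {M : ℕ | ∀ W : List (Fin q), W.length = M → Encounters W (Zimin n)}

/-- `ZC n q M` is the set of `q`-ary words of length `M` that are instances of `Zₙ`. -/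
def ZC (n q M : ℕ) : Set (List (Fin q)) :=
  {W | W.length = M ∧ IsInst (Zimin n) W}

/-- `u` has a prefix `X ++ C ++ X` with `C` nonempty, where `X` has length at least three and its
first and last letters agree. -/
def HasReturningPrefix (u : List Bool) : Prop :=
  ∃ a c B, a :: c :: (B ++ [a]) <+: u ∧
    ∃ j, B.length + 4 ≤ j ∧ a :: c :: (B ++ [a]) <+: u.drop j

theorem encounters_zimin_three_iff (u : List Bool) :
    Encounters u (Zimin 3) ↔ ∃ s, s <:+ u ∧ HasReturningPrefix s := by
  constructor
  · rintro ⟨W, ⟨p, q, rfl⟩, φ, hφ, rfl⟩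
    have h0 := hφ 0 (by decide)
    have h1 := hφ 1 (by decide)
    obtain ⟨a, A, hA⟩ := List.exists_cons_of_ne_nil h0
    obtain ⟨b, B, hB⟩ := List.exists_cons_of_ne_nil h1
    obtain ⟨d, D, hD⟩ := List.exists_cons_of_ne_nil (hφ 2 (by decide))
    obtain ⟨c, E, hE⟩ := List.exists_cons_of_ne_nil (show A ++ b :: B ≠ [] by simp)
    have hE' : ∀ t, A ++ b :: (B ++ t) = c :: (E ++ t) := fun t => by
      simpa using congrArg (· ++ t) hE
    refine ⟨_, ⟨p, by rw [List.append_assoc]⟩, a, c, E, ?_, E.length + 3 + A.length + (D.length + 1),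
      by omega, ?_⟩
    · refine ⟨A ++ d :: D ++ a :: c :: (E ++ a :: A) ++ q, ?_⟩
      simp [Zimin, hA, hB, hD, hE']
    · refine ⟨A ++ q, ?_⟩
      have : List.flatten (List.map φ (Zimin 3)) ++ q =
          (a :: c :: (E ++ [a]) ++ A ++ d :: D) ++ (a :: c :: (E ++ [a]) ++ (A ++ q)) := by
        simp [Zimin, hA, hB, hD, hE']
      rw [this, List.drop_left']
      simp
      omega
  · rintro ⟨s, ⟨p, rfl⟩, a, c, B, ⟨t, rfl⟩, j, hj, ⟨q, hq⟩⟩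
    set X := a :: c :: (B ++ [a]) with hX
    have hlen : X.length = B.length + 3 := by simp [hX]
    have hd : (X ++ t).drop j = t.drop (j - X.length) := by
      rw [List.drop_append, List.drop_eq_nil_of_le (by omega), List.nil_append]
    rw [hd] at hq
    have ht : t = t.take (j - X.length) ++ (X ++ q) := by rw [hq, List.take_append_drop]
    have hC : t.take (j - X.length) ≠ [] := by
      intro h
      rcases List.take_eq_nil_iff.1 h with h | h
      · omega
      · simp [h, hX] at hq
    generalize t.take (j - X.length) = C at ht hC
    subst ht
    refine ⟨X ++ C ++ X, ⟨p, q, by simp⟩,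
      fun n => if n = 0 then [a] else if n = 1 then c :: B else C, ?_, ?_⟩
    · intro n _
      dsimp only
      split_ifs <;> simp [hC]
    · simp [Zimin, hX]

theorem avoids_cons_iff (b : Bool) (w : List Bool) :
    Avoids (b :: w) (Zimin 3) ↔ ¬ HasReturningPrefix (b :: w) ∧ Avoids w (Zimin 3) := by
  simp only [Avoids, encounters_zimin_three_iff, List.suffix_cons_iff]
  grind

theorem avoids_of_suffix {α β : Type} {V : List α} {u w : List β} (h : w <:+ u)
    (hu : Avoids u V) : Avoids w V :=
  fun ⟨W, hW, hV⟩ => hu ⟨W, hW.trans h.isInfix, hV⟩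

/-- Extends a match of a prefix of `u` along the letters of `v` up to the first letter `a`. The bits
of `P` and `Q` mark the occurrences of `false` and `true`, those of `M` the occurrences of the prefix
read so far. The result tells whether a position at or beyond the one marked by `k`, which doubles
with each letter, survives. Written with recursors to speed up evaluation in the kernel. -/
noncomputable def scan (a : Bool) (v : List Bool) : ℕ → ℕ → ℕ → ℕ → Bool :=
  List.rec (fun _ _ _ _ => false) (fun x _ ih k P Q M =>
    Bool.rec
      (Bool.rec (Nat.ble k (Nat.land M P))
        (ih (Nat.mul 2 k) (Nat.div P 2) (Nat.div Q 2) (Nat.land M Q)) x)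
      (Bool.rec (ih (Nat.mul 2 k) (Nat.div P 2) (Nat.div Q 2) (Nat.land M P))
        (Nat.ble k (Nat.land M Q)) x)
      a) v

theorem scan_cons (a x : Bool) (v : List Bool) (k P Q M : ℕ) :
    scan a (x :: v) k P Q M =
      if x = a then decide (k ≤ M &&& bif x then Q else P)
      else scan a v (2 * k) (P / 2) (Q / 2) (M &&& bif x then Q else P) := by
  cases a <;> cases x <;> first | rfl | exact Bool.eq_iff_iff.2 ((iff_of_eq Nat.ble_eq).trans decide_eq_true_iff.symm)

/-- Decides `HasReturningPrefix (a :: w)`, where the bits of `P` and `Q` mark the occurrences of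
`false` and `true` in `a :: w`. -/
noncomputable def scanCons (a : Bool) (w : List Bool) (P Q : ℕ) : Bool :=
  List.rec false (fun c v _ => scan a v 16 (Nat.div P 4) (Nat.div Q 4)
    (Nat.land (Bool.rec P Q a) (Bool.rec (Nat.div P 2) (Nat.div Q 2) c))) w

theorem scanCons_cons (a c : Bool) (v : List Bool) (P Q : ℕ) :
    scanCons a (c :: v) P Q =
      scan a v 16 (P / 4) (Q / 4) ((bif a then Q else P) &&& (bif c then Q else P) / 2) := by
  cases a <;> cases c <;> rfl

/-- The number of ways to extend `w` by `n` letters to the left such that no new suffix satisfies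
`HasReturningPrefix`; the bits of `P` and `Q` mark the occurrences of `false` and `true` in `w`. -/
noncomputable def countExtensions (n : ℕ) : List Bool → ℕ → ℕ → ℕ :=
  Nat.rec (fun _ _ _ => 1) (fun _ ih w P Q =>
    Nat.add
      (Bool.rec (ih (true :: w) (Nat.mul 2 P) (Nat.succ (Nat.mul 2 Q))) 0
        (scanCons true w (Nat.mul 2 P) (Nat.succ (Nat.mul 2 Q))))
      (Bool.rec (ih (false :: w) (Nat.succ (Nat.mul 2 P)) (Nat.mul 2 Q)) 0
        (scanCons false w (Nat.succ (Nat.mul 2 P)) (Nat.mul 2 Q)))) n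

theorem countExtensions_succ (n : ℕ) (w : List Bool) (P Q : ℕ) :
    countExtensions (n + 1) w P Q =
      (bif scanCons true w (2 * P) (2 * Q + 1) then 0
        else countExtensions n (true :: w) (2 * P) (2 * Q + 1)) +
      (bif scanCons false w (2 * P + 1) (2 * Q) then 0
        else countExtensions n (false :: w) (2 * P + 1) (2 * Q)) := by
  have h : ∀ (b : Bool) (m : ℕ), (bif b then 0 else m) = Bool.rec m 0 b := by
    intro b m; cases b <;> rfl
  rw [h, h]
  rfl

theorem countExtensions_eq : countExtensions 28 [] 0 0 = 48 := by
  decide +kernel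

/-- The bits of `P` mark the positions of the letter `b` in `u`. -/
def IsMask (b : Bool) (u : List Bool) (P : ℕ) : Prop :=
  ∀ j, P.testBit j = true ↔ u[j]? = some b

theorem IsMask.cons_self {b : Bool} {u : List Bool} {P : ℕ} (h : IsMask b u P) :
    IsMask b (b :: u) (2 * P + 1) := by
  intro j
  cases j with
  | zero => simp
  | succ j => simpa [Nat.testBit_succ, Nat.mul_add_div] using h j

theorem IsMask.cons_of_ne {b c : Bool} {u : List Bool} {P : ℕ} (h : IsMask b u P) (hc : c ≠ b) :
    IsMask b (c :: u) (2 * P) := by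
  intro j
  cases j with
  | zero => simpa using hc
  | succ j => simpa [Nat.testBit_succ] using h j

theorem two_pow_le_iff_exists_testBit (m M : ℕ) :
    2 ^ m ≤ M ↔ ∃ j, m ≤ j ∧ M.testBit j = true := by
  constructor
  · intro h
    obtain ⟨j, hj, hM⟩ := Nat.exists_ge_and_testBit_of_ge_two_pow h
    exact ⟨j, hj, hM⟩
  · rintro ⟨j, hj, hM⟩
    exact (Nat.pow_le_pow_right two_pos hj).trans (Nat.ge_two_pow_of_testBit hM)

theorem append_singleton_prefix_iff {α : Type} (p l : List α) (x : α) :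
    p ++ [x] <+: l ↔ p <+: l ∧ l[p.length]? = some x := by
  constructor
  · rintro ⟨t, rfl⟩
    simp
  · rintro ⟨⟨t, rfl⟩, h⟩
    cases t with
    | nil => simp at h
    | cons y t =>
      simp at h
      exact ⟨t, by simp [h]⟩

theorem scan_eq_true_iff (a : Bool) (u v : List Bool) (p : List Bool) (P Q M : ℕ)
    (hu : u = p ++ v)
    (hP : ∀ j, P.testBit j = true ↔ u[j + p.length]? = some false)
    (hQ : ∀ j, Q.testBit j = true ↔ u[j + p.length]? = some true)
    (hM : ∀ j, M.testBit j = true ↔ p <+: u.drop j) :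
    scan a v (2 ^ (p.length + 2)) P Q M = true ↔
      ∃ B, a ∉ B ∧ B ++ [a] <+: v ∧
        ∃ j, p.length + B.length + 2 ≤ j ∧ p ++ (B ++ [a]) <+: u.drop j := by
  induction v generalizing p P Q M with
  | nil => simp [scan]
  | cons x v ih =>
    have hM' : ∀ j, (M &&& bif x then Q else P).testBit j = true ↔ p ++ [x] <+: u.drop j := by
      intro j
      rw [append_singleton_prefix_iff, Nat.testBit_and, Bool.and_eq_true, hM, List.getElem?_drop]
      cases x <;> simp [hP, hQ]
    rw [scan_cons]
    split_ifs with hx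
    · subst hx
      rw [decide_eq_true_iff, two_pow_le_iff_exists_testBit]
      simp only [hM']
      constructor
      · rintro ⟨j, hj, h⟩
        exact ⟨[], by simp, by simp, j, by simpa using hj, by simpa using h⟩
      · rintro ⟨B, hB, hpre, j, hj, h⟩
        cases B with
        | nil => exact ⟨j, by simpa using hj, by simpa using h⟩
        | cons y B =>
          simp at hpre hB
          exact absurd hpre.1.symm hB.1
    · have hk : 2 * 2 ^ (p.length + 2) = 2 ^ ((p ++ [x]).length + 2) := by
        simp; ring
      rw [hk, ih (p ++ [x]) _ _ _ (by simp [hu]) _ _ hM']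
      · constructor
        · rintro ⟨B, hB, hpre, j, hj, h⟩
          refine ⟨x :: B, by simp [hB, Ne.symm hx], by simpa using hpre, j, ?_, by simpa using h⟩
          simp at hj ⊢
          omega
        · rintro ⟨B, hB, hpre, j, hj, h⟩
          cases B with
          | nil =>
            simp at hpre
            exact absurd hpre.symm hx
          | cons y B =>
            simp at hpre hB
            obtain ⟨rfl, hpre⟩ := hpre
            refine ⟨B, hB.2, hpre, j, ?_, by simpa using h⟩
            simp at hj ⊢
            omega
      · intro j
        rw [← Nat.testBit_succ, hP]
        simp [Nat.add_assoc, Nat.add_comm 1]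
      · intro j
        rw [← Nat.testBit_succ, hQ]
        simp [Nat.add_assoc, Nat.add_comm 1]

theorem hasReturningPrefix_cons_cons_iff (a c : Bool) (v : List Bool) :
    HasReturningPrefix (a :: c :: v) ↔
      ∃ B, a ∉ B ∧ B ++ [a] <+: v ∧
        ∃ j, B.length + 4 ≤ j ∧ a :: c :: (B ++ [a]) <+: (a :: c :: v).drop j := by
  constructor
  · rintro ⟨a', c', B, hpre, j, hj, h⟩
    obtain ⟨rfl, rfl, hB⟩ : a' = a ∧ c' = c ∧ B ++ [a'] <+: v := by simpa using hpre
    obtain ⟨s, t, hs, hst⟩ := List.eq_append_cons_of_mem (show a' ∈ B ++ [a'] by simp)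
    have hsB : s ++ [a'] <+: B ++ [a'] := ⟨t, by simp [hs]⟩
    have hlen := hsB.length_le
    simp at hlen
    exact ⟨s, hst, hsB.trans hB, j, by omega,
      List.IsPrefix.trans (by simpa using hsB) h⟩
  · rintro ⟨B, -, hpre, j, hj, h⟩
    exact ⟨a, c, B, by simpa using hpre, j, hj, h⟩

theorem scanCons_eq_true_iff (a : Bool) (w : List Bool) (P Q : ℕ)
    (hP : IsMask false (a :: w) P) (hQ : IsMask true (a :: w) Q) :
    scanCons a w P Q = true ↔ HasReturningPrefix (a :: w) := by
  cases w with
  | nil => simp [scanCons, HasReturningPrefix]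
  | cons c v =>
    rw [scanCons_cons, hasReturningPrefix_cons_cons_iff]
    refine (scan_eq_true_iff a (a :: c :: v) v [a, c] _ _ _ rfl ?_ ?_ ?_).trans ?_
    · intro j
      rw [show P / 4 = P / 2 / 2 by omega, ← Nat.testBit_succ, ← Nat.testBit_succ, hP]
      rfl
    · intro j
      rw [show Q / 4 = Q / 2 / 2 by omega, ← Nat.testBit_succ, ← Nat.testBit_succ, hQ]
      rfl
    · intro j
      rw [show [a, c] = ([] ++ [a]) ++ [c] from rfl, append_singleton_prefix_iff,
        append_singleton_prefix_iff, Nat.testBit_and, Bool.and_eq_true, ← Nat.testBit_succ]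
      cases a <;> cases c <;> simp [hP _, hQ _]
    · simp [Nat.add_comm, Nat.add_left_comm]

theorem ncard_avoiding_extensions (n : ℕ) (w : List Bool) (P Q : ℕ)
    (hP : IsMask false w P) (hQ : IsMask true w Q) (hw : Avoids w (Zimin 3)) :
    {z : List Bool | z.length = n ∧ Avoids (z ++ w) (Zimin 3)}.ncard =
      countExtensions n w P Q := by
  induction n generalizing w P Q with
  | zero =>
    have : {z : List Bool | z.length = 0 ∧ Avoids (z ++ w) (Zimin 3)} = {[]} := by
      ext z
      simp +contextual [hw]
    rw [this, Set.ncard_singleton]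
    rfl
  | succ n ih =>
    let S (b : Bool) : Set (List Bool) :=
      {z | z.length = n ∧ Avoids (z ++ b :: w) (Zimin 3)}
    have hunion : {z : List Bool | z.length = n + 1 ∧ Avoids (z ++ w) (Zimin 3)} =
        (· ++ [true]) '' S true ∪ (· ++ [false]) '' S false := by
      ext z
      constructor
      · rintro ⟨hz, h⟩
        obtain rfl | ⟨y, b, rfl⟩ := List.eq_nil_or_concat' z
        · simp at hz
        · cases b
          · exact Or.inr ⟨y, ⟨by simpa using hz, by simpa using h⟩, rfl⟩
          · exact Or.inl ⟨y, ⟨by simpa using hz, by simpa using h⟩, rfl⟩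
      · rintro (⟨y, ⟨hy, h⟩, rfl⟩ | ⟨y, ⟨hy, h⟩, rfl⟩) <;>
          exact ⟨by simp [hy], by simpa using h⟩
    have hfin (b : Bool) : (S b).Finite :=
      (List.finite_length_eq Bool n).subset fun z hz => hz.1
    have hdisj : Disjoint ((· ++ [true]) '' S true) ((· ++ [false]) '' S false) := by
      rw [Set.disjoint_left]
      rintro _ ⟨y, -, rfl⟩ ⟨z, -, h⟩
      simp at h
    have hcard (b : Bool) (P Q : ℕ) (hP : IsMask false (b :: w) P)
        (hQ : IsMask true (b :: w) Q) :
        (S b).ncard = bif scanCons b w P Q then 0 else countExtensions n (b :: w) P Q := by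
      have hscan := scanCons_eq_true_iff b w P Q hP hQ
      by_cases h : HasReturningPrefix (b :: w)
      · have : S b = ∅ := Set.eq_empty_of_forall_notMem fun z hz =>
          ((avoids_cons_iff b w).1 (avoids_of_suffix (List.suffix_append z _) hz.2)).1 h
        simp [this, hscan.2 h]
      · rw [Bool.eq_false_iff.2 fun hs => h (hscan.1 hs)]
        exact ih _ _ _ hP hQ ((avoids_cons_iff b w).2 ⟨h, hw⟩)
    rw [hunion, Set.ncard_union_eq hdisj ((hfin _).image _) ((hfin _).image _),
      Set.ncard_image_of_injective _ (List.append_left_injective _),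
      Set.ncard_image_of_injective _ (List.append_left_injective _), countExtensions_succ,
      hcard true _ _ (hP.cons_of_ne (by simp)) hQ.cons_self,
      hcard false _ _ hP.cons_self (hQ.cons_of_ne (by simp))]

theorem Encounters.map {α β γ : Type} {V : List α} {U : List β} (f : β → γ)
    (h : Encounters U V) : Encounters (U.map f) V := by
  obtain ⟨W, hW, φ, hφ, rfl⟩ := h
  refine ⟨_, hW.map f, fun a => (φ a).map f, fun a ha => by simpa using hφ a ha, ?_⟩
  simp [List.map_flatten, Function.comp_def]

theorem avoids_map_equiv_iff {α β γ : Type} {V : List α} {U : List β} (e : β ≃ γ) :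
    Avoids (U.map e) V ↔ Avoids U V :=
  not_congr ⟨fun h => by simpa using h.map e.symm, fun h => h.map e⟩

/-- There are exactly 48 binary words of length 28 that avoid `Z₃ = abacaba`. -/
theorem avoid_Z3_length28_count :
    {W : List (Fin 2) | W.length = 28 ∧ Avoids W (Zimin 3)}.ncard = 48 := by
  have hnil : Avoids ([] : List Bool) (Zimin 3) := by
    rw [Avoids, encounters_zimin_three_iff]
    rintro ⟨s, hs, h⟩
    simp [List.suffix_nil.1 hs, HasReturningPrefix] at h
  have hcard := ncard_avoiding_extensions 28 [] 0 0 (fun j => by simp) (fun j => by simp) hnil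
  rw [countExtensions_eq] at hcard
  rw [← hcard, ← Set.ncard_image_of_injective _
    (List.map_injective_iff.2 finTwoEquiv.injective)]
  congr 1
  ext z
  constructor
  · rintro ⟨W, ⟨hW, h⟩, rfl⟩
    exact ⟨by simpa using hW, by simpa using (avoids_map_equiv_iff _).2 h⟩
  · rintro ⟨hz, h⟩
    refine ⟨z.map finTwoEquiv.symm, ⟨by simpa using hz, ?_⟩, by simp⟩
    exact (avoids_map_equiv_iff _).2 (by simpa using h)
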